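/- For every graph G (given by a symmetric 0-1 adjacency matrix on a finite nonempty vertex set) and every integer N ≥ 1, the ground energies of the Bose–Hubbard model satisfy λ_{N+1}^1(G) ≥ λ_N^1(G). -/

import Mathlib

namespace BH

variable {V : Type*} [Fintype V] [DecidableEq V]

/-- The operator `M` acting on the `w`-th factor of the `N`-fold tensor power
`(ℂ^V)^{⊗N}`, the latter identified with `ℂ^{V^N}`. -/
noncomputable def onFactor (N : ℕ) (M : Matrix V V ℂ) (w : Fin N) :
    Matrix (Fin N → V) (Fin N → V) ℂ :=
  Matrix.of fun x y =>
    (if ∀ u, u ≠ w → x u = y u then (1 : ℂ) else 0) * M (x w) (y w)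

/-- The Bose–Hubbard interaction term
`Σ_{k ∈ V} Σ_{w ≠ w'} (|k⟩⟨k|)^{(w)} (|k⟩⟨k|)^{(w')}`, a diagonal matrix whose diagonal
entry at a configuration `x : Fin N → V` counts the ordered pairs of distinct particles
sitting at a common vertex. -/
noncomputable def interaction (V : Type*) [DecidableEq V] (N : ℕ) :
    Matrix (Fin N → V) (Fin N → V) ℂ :=
  Matrix.of fun x y =>
    if x = y then
      (((Finset.univ : Finset (Fin N × Fin N)).filter
          fun p => p.1 ≠ p.2 ∧ x p.1 = x p.2).card : ℂ)
    else 0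

/-- The `N`-particle Bose–Hubbard Hamiltonian `H_G^N` (with hopping and interaction
strengths equal to `1`) for the graph with adjacency matrix `A`. -/
noncomputable def bhHam (A : Matrix V V ℂ) (N : ℕ) :
    Matrix (Fin N → V) (Fin N → V) ℂ :=
  (∑ w : Fin N, onFactor N A w) + interaction V N

/-- The bosonic (symmetric) subspace `Z_N(G)`: states invariant under every permutation
of the `N` tensor factors. -/
def symmStates (V : Type*) (N : ℕ) : Set ((Fin N → V) → ℂ) :=
  { ψ | ∀ σ : Equiv.Perm (Fin N), ∀ x : Fin N → V, ψ (x ∘ σ) = ψ x }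

/-- The ground energy (smallest eigenvalue) of the compression of a Hermitian matrix `H`
to a subspace given as a set `Z` of states: the infimum of the Rayleigh quotients
`⟨ψ, H ψ⟩` over unit vectors `ψ ∈ Z`. -/
noncomputable def groundEnergy {ι : Type*} [Fintype ι]
    (H : Matrix ι ι ℂ) (Z : Set (ι → ℂ)) : ℝ :=
  sInf { r : ℝ | ∃ ψ ∈ Z, dotProduct (star ψ) ψ = 1 ∧
    r = (dotProduct (star ψ) (H.mulVec ψ)).re }

/-- `μ(G)`: the smallest eigenvalue of the adjacency matrix `A = A(G)`. -/
noncomputable def mu (A : Matrix V V ℂ) : ℝ :=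
  groundEnergy A Set.univ

/-- `λ_N^1(G)`: the smallest eigenvalue of `H(G,N)`, the restriction of
`H_G^N − N μ(G)·1` to the symmetric subspace `Z_N(G)`. -/
noncomputable def lambda1 (A : Matrix V V ℂ) (N : ℕ) : ℝ :=
  groundEnergy (bhHam A N - ((N : ℂ) * (mu A : ℂ)) • 1) (symmStates V N)

end BH

namespace BH

lemma quad_eq {ι : Type*} [Fintype ι] (H : Matrix ι ι ℂ) (ψ : ι → ℂ) :
    dotProduct (star ψ) (H.mulVec ψ) = ∑ i, ∑ j, star (ψ i) * (H i j * ψ j) := by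
  simp only [dotProduct, Matrix.mulVec, Finset.mul_sum, Pi.star_apply]

lemma norm_eq {ι : Type*} [Fintype ι] (ψ : ι → ℂ) :
    dotProduct (star ψ) ψ = ((∑ i, ‖ψ i‖ ^ 2 : ℝ) : ℂ) := by
  simp only [dotProduct, Pi.star_apply]
  push_cast
  refine Finset.sum_congr rfl fun i _ => ?_
  have := Complex.conj_mul' (ψ i)
  simpa using this

lemma rayleigh_bdd {ι : Type*} [Fintype ι] (H : Matrix ι ι ℂ) (Z : Set (ι → ℂ)) :
    BddBelow { r : ℝ | ∃ ψ ∈ Z, dotProduct (star ψ) ψ = 1 ∧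
      r = (dotProduct (star ψ) (H.mulVec ψ)).re } := by
  refine ⟨-∑ i, ∑ j, ‖H i j‖, ?_⟩
  rintro r ⟨ψ, -, h1, rfl⟩
  rw [norm_eq] at h1
  have h1' : ∑ i, ‖ψ i‖ ^ 2 = 1 := by exact_mod_cast h1
  have hle : ∀ i, ‖ψ i‖ ≤ 1 := by
    intro i
    have : ‖ψ i‖ ^ 2 ≤ ∑ i, ‖ψ i‖ ^ 2 :=
      Finset.single_le_sum (f := fun i => ‖ψ i‖ ^ 2) (fun i _ => by positivity) (Finset.mem_univ i)
    rw [h1'] at this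
    nlinarith [norm_nonneg (ψ i)]
  rw [quad_eq]
  have hb : ‖∑ i, ∑ j, star (ψ i) * (H i j * ψ j)‖ ≤ ∑ i, ∑ j, ‖H i j‖ := by
    refine (norm_sum_le _ _).trans (Finset.sum_le_sum fun i _ => ?_)
    refine (norm_sum_le _ _).trans (Finset.sum_le_sum fun j _ => ?_)
    rw [norm_mul, norm_mul, norm_star]
    have h2 : ‖H i j‖ * ‖ψ j‖ ≤ ‖H i j‖ := mul_le_of_le_one_right (norm_nonneg _) (hle j)
    exact (mul_le_of_le_one_left (by positivity) (hle i)).trans h2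
  have := (Complex.abs_re_le_norm (∑ i, ∑ j, star (ψ i) * (H i j * ψ j))).trans hb
  linarith [(abs_le.1 this).1]

lemma ground_le {ι : Type*} [Fintype ι] (H : Matrix ι ι ℂ) (Z : Set (ι → ℂ))
    (hZ : ∀ (c : ℂ) (ψ : ι → ℂ), ψ ∈ Z → c • ψ ∈ Z) (ψ : ι → ℂ) (hψ : ψ ∈ Z) :
    groundEnergy H Z * ∑ i, ‖ψ i‖ ^ 2 ≤ (∑ i, ∑ j, star (ψ i) * (H i j * ψ j)).re := by
  set s := ∑ i, ‖ψ i‖ ^ 2 with hs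
  have hs0 : 0 ≤ s := Finset.sum_nonneg fun i _ => by positivity
  rcases hs0.eq_or_lt with h0 | hpos
  · have hz : ∀ i, ψ i = 0 := by
      intro i
      have := (Finset.sum_eq_zero_iff_of_nonneg (fun i _ => by positivity)).1 (hs ▸ h0.symm) i
        (Finset.mem_univ i)
      simpa using this
    simp [hz, ← h0]
  · set c : ℝ := (Real.sqrt s)⁻¹ with hc
    have hc2 : c ^ 2 * s = 1 := by
      rw [hc, inv_pow, Real.sq_sqrt hs0, inv_mul_cancel₀ hpos.ne']
    have hmem : groundEnergy H Z ≤
        (dotProduct (star ((c : ℂ) • ψ)) (H.mulVec ((c : ℂ) • ψ))).re := by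
      refine csInf_le (rayleigh_bdd H Z) ⟨(c : ℂ) • ψ, hZ _ _ hψ, ?_, rfl⟩
      rw [norm_eq]
      simp only [Pi.smul_apply, smul_eq_mul, norm_mul, mul_pow, Complex.norm_real,
        Real.norm_eq_abs, sq_abs]
      rw [← Finset.mul_sum, ← hs, hc2]
      simp
    rw [quad_eq] at hmem
    have he : ∑ i, ∑ j, star (((c : ℂ) • ψ) i) * (H i j * ((c : ℂ) • ψ) j)
        = ((c ^ 2 : ℝ) : ℂ) * ∑ i, ∑ j, star (ψ i) * (H i j * ψ j) := by
      simp only [Finset.mul_sum]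
      refine Finset.sum_congr rfl fun i _ => Finset.sum_congr rfl fun j _ => ?_
      simp
      ring
    rw [he, Complex.re_ofReal_mul] at hmem
    calc groundEnergy H Z * s ≤ (c ^ 2 * (∑ i, ∑ j, star (ψ i) * (H i j * ψ j)).re) * s :=
          mul_le_mul_of_nonneg_right hmem hs0
      _ = (c ^ 2 * s) * (∑ i, ∑ j, star (ψ i) * (H i j * ψ j)).re := by ring
      _ = _ := by rw [hc2, one_mul]

lemma symm_slice {V : Type*} {N : ℕ} (ψ : (Fin (N + 1) → V) → ℂ) (h : ψ ∈ symmStates V (N + 1))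
    (v : V) : (fun x : Fin N → V => ψ (Fin.cons v x)) ∈ symmStates V N := by
  intro σ x
  have := h (Equiv.Perm.decomposeFin.symm (0, σ)) (Fin.cons v x)
  refine Eq.trans ?_ this
  show ψ _ = ψ _
  congr 1
  funext i
  refine Fin.cases ?_ (fun j => ?_) i <;> simp

section
variable {V : Type*} [Fintype V] [DecidableEq V]

lemma onFactor_zero (N : ℕ) (A : Matrix V V ℂ) (v v' : V) (x y : Fin N → V) :
    onFactor (N + 1) A 0 (Fin.cons v x : Fin (N + 1) → V) (Fin.cons v' y : Fin (N + 1) → V)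
      = if x = y then A v v' else 0 := by
  simp [onFactor, Fin.forall_fin_succ, funext_iff]

lemma onFactor_succ (N : ℕ) (A : Matrix V V ℂ) (w : Fin N) (v v' : V) (x y : Fin N → V) :
    onFactor (N + 1) A w.succ (Fin.cons v x : Fin (N + 1) → V) (Fin.cons v' y : Fin (N + 1) → V)
      = if v = v' then onFactor N A w x y else 0 := by
  have h0 : (0 : Fin (N + 1)) ≠ w.succ := (Fin.succ_ne_zero w).symm
  by_cases h : v = v' <;> simp [onFactor, Fin.forall_fin_succ, h0, h]

/-- pair count -/
def cnt {N : ℕ} (x : Fin N → V) : ℕ :=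
  ((Finset.univ : Finset (Fin N × Fin N)).filter
          fun p => p.1 ≠ p.2 ∧ x p.1 = x p.2).card

lemma cnt_le {N : ℕ} (v : V) (x : Fin N → V) :
    cnt x ≤ cnt (Fin.cons v x : Fin (N + 1) → V) := by
  refine Finset.card_le_card_of_injOn (fun p => (p.1.succ, p.2.succ)) ?_ ?_
  · intro p hp
    simpa using hp
  · rintro ⟨a, b⟩ _ ⟨c, d⟩ _ h
    simpa using h

lemma entry (N : ℕ) (A : Matrix V V ℂ) (m : ℂ) (v v' : V) (x y : Fin N → V) :
    (bhHam A (N + 1) - (((N + 1 : ℕ) : ℂ) * m) • 1) (Fin.cons v x : Fin (N + 1) → V)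
        (Fin.cons v' y : Fin (N + 1) → V)
      = (if v = v' then (bhHam A N - ((N : ℂ) * m) • 1) x y else 0)
        + (if x = y then (A - m • 1) v v' else 0)
        + (if v = v' then if x = y then
            (((cnt (Fin.cons v x : Fin (N + 1) → V) : ℝ) - (cnt x : ℝ) : ℝ) : ℂ) else 0 else 0) := by
  have hi : ∀ (M : ℕ) (x y : Fin M → V), interaction V M x y = if x = y then (cnt x : ℂ) else 0 :=
    fun _ _ _ => rfl
  simp only [bhHam, Matrix.sub_apply, Matrix.add_apply, Matrix.sum_apply, Matrix.smul_apply,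
    Fin.sum_univ_succ, onFactor_zero, onFactor_succ, hi, Matrix.one_apply, Fin.cons_inj]
  by_cases h : v = v' <;> by_cases h' : x = y <;> simp [h, h'] <;> ring

lemma sum_cons {M : Type*} [AddCommMonoid M] (N : ℕ) (f : (Fin (N + 1) → V) → M) :
    ∑ z, f z = ∑ v, ∑ x : Fin N → V, f (Fin.cons v x) := by
  rw [← Fintype.sum_prod_type']
  exact (Equiv.sum_comp (Fin.consEquiv (fun _ : Fin (N + 1) => V)) f).symm

lemma quad_shift (A : Matrix V V ℂ) (ψ : V → ℂ) :
    0 ≤ (∑ i, ∑ j, star (ψ i) * ((A - (mu A : ℂ) • 1) i j * ψ j)).re := by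
  have h := ground_le A Set.univ (fun _ _ _ => trivial) ψ trivial
  change mu A * _ ≤ _ at h
  have : ∑ i, ∑ j, star (ψ i) * ((A - (mu A : ℂ) • 1) i j * ψ j)
      = (∑ i, ∑ j, star (ψ i) * (A i j * ψ j)) - ((mu A * ∑ i, ‖ψ i‖ ^ 2 : ℝ) : ℂ) := by
    rw [Complex.ofReal_mul, ← norm_eq]
    simp only [Matrix.sub_apply, sub_mul, mul_sub, Finset.sum_sub_distrib, Matrix.smul_apply,
      Matrix.one_apply, dotProduct, Finset.mul_sum]
    congr 1
    refine Finset.sum_congr rfl fun i _ => ?_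
    simp
    ring
  rw [this, Complex.sub_re, Complex.ofReal_re]
  linarith

lemma quad_split (N : ℕ) (A : Matrix V V ℂ) (m : ℂ) (ψ : (Fin (N + 1) → V) → ℂ) :
    (∑ i, ∑ j, star (ψ i) * ((bhHam A (N + 1) - (((N + 1 : ℕ) : ℂ) * m) • 1) i j * ψ j))
      = (∑ v, ∑ x : Fin N → V, ∑ y : Fin N → V, star (ψ (Fin.cons v x)) *
          ((bhHam A N - ((N : ℂ) * m) • 1) x y * ψ (Fin.cons v y)))
        + (∑ x : Fin N → V, ∑ v, ∑ v', star (ψ (Fin.cons v x)) *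
          ((A - m • 1) v v' * ψ (Fin.cons v' x)))
        + ∑ v, ∑ x : Fin N → V, ((((cnt (Fin.cons v x : Fin (N + 1) → V) : ℝ) - (cnt x : ℝ))
            * ‖ψ (Fin.cons v x)‖ ^ 2 : ℝ) : ℂ) := by
  simp only [sum_cons, entry, add_mul, mul_add, Finset.sum_add_distrib]
  congr 1
  · congr 1
    · refine Finset.sum_congr rfl fun v _ => Finset.sum_congr rfl fun x _ => ?_
      rw [Finset.sum_comm]
      simp
    · rw [Finset.sum_comm]
      refine Finset.sum_congr rfl fun x _ => Finset.sum_congr rfl fun v _ =>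
        Finset.sum_congr rfl fun v' _ => ?_
      simp
  · refine Finset.sum_congr rfl fun v _ => Finset.sum_congr rfl fun x _ => ?_
    have := Complex.conj_mul' (ψ (Fin.cons v x))
    rw [Complex.ofReal_mul, Complex.ofReal_pow, ← this, Finset.sum_comm]
    simp
    ring

end

end BH


/-- For every graph `G` (given by a symmetric 0-1 adjacency matrix on a
finite nonempty vertex set) and every integer `N ≥ 1`, the ground energies of the
Bose–Hubbard model satisfy `λ_{N+1}^1(G) ≥ λ_N^1(G)`. -/
theorem bh_ground_energy_monotone
    {V : Type*} [Fintype V] [DecidableEq V] [Nonempty V]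
    (A : Matrix V V ℂ) (hsymm : A.IsSymm)
    (h01 : ∀ i j, A i j = 0 ∨ A i j = 1)
    (N : ℕ) (hN : 1 ≤ N) :
    BH.lambda1 A N ≤ BH.lambda1 A (N + 1) := by
  classical
  unfold BH.lambda1
  refine le_csInf ?_ ?_
  · set k : ℝ := ((Fintype.card (Fin (N + 1) → V) : ℕ) : ℝ) with hk
    have hk0 : 0 < k := by rw [hk]; exact_mod_cast Fintype.card_pos
    refine ⟨_, fun _ => (((Real.sqrt k)⁻¹ : ℝ) : ℂ), fun σ x => rfl, ?_, rfl⟩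
    rw [BH.norm_eq]
    simp only [Complex.norm_real, Real.norm_eq_abs, sq_abs, Finset.sum_const, nsmul_eq_mul,
      Finset.card_univ, inv_pow, Real.sq_sqrt hk0.le]
    rw [← hk, mul_inv_cancel₀ hk0.ne']
    simp
  · rintro r ⟨ψ, hψ, h1, rfl⟩
    rw [BH.norm_eq] at h1
    have h1' : ∑ i, ‖ψ i‖ ^ 2 = 1 := by exact_mod_cast h1
    rw [BH.sum_cons] at h1'
    rw [BH.quad_eq, BH.quad_split, Complex.add_re, Complex.add_re]
    have hA : 0 ≤ (∑ x : Fin N → V, ∑ v, ∑ v', star (ψ (Fin.cons v x)) *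
          ((A - (BH.mu A : ℂ) • 1) v v' * ψ (Fin.cons v' x))).re := by
      rw [Complex.re_sum]
      exact Finset.sum_nonneg fun x _ => BH.quad_shift A (fun v => ψ (Fin.cons v x))
    have hC : 0 ≤ (∑ v, ∑ x : Fin N → V,
        ((((BH.cnt (Fin.cons v x : Fin (N + 1) → V) : ℝ) - (BH.cnt x : ℝ))
            * ‖ψ (Fin.cons v x)‖ ^ 2 : ℝ) : ℂ)).re := by
      rw [Complex.re_sum]
      refine Finset.sum_nonneg fun v _ => ?_
      rw [Complex.re_sum]
      refine Finset.sum_nonneg fun x _ => ?_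
      rw [Complex.ofReal_re]
      have : (BH.cnt x : ℝ) ≤ (BH.cnt (Fin.cons v x : Fin (N + 1) → V) : ℝ) := by
        exact_mod_cast BH.cnt_le v x
      exact mul_nonneg (sub_nonneg.2 this) (by positivity)
    have hB : BH.groundEnergy (BH.bhHam A N - ((N : ℂ) * (BH.mu A : ℂ)) • 1) (BH.symmStates V N)
        ≤ (∑ v, ∑ x : Fin N → V, ∑ y : Fin N → V, star (ψ (Fin.cons v x)) *
          ((BH.bhHam A N - ((N : ℂ) * (BH.mu A : ℂ)) • 1) x y * ψ (Fin.cons v y))).re := by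
      rw [Complex.re_sum]
      conv_lhs => rw [← mul_one (BH.groundEnergy _ _), ← h1', Finset.mul_sum]
      refine Finset.sum_le_sum fun v _ => ?_
      refine BH.ground_le _ _ ?_ (fun x => ψ (Fin.cons v x)) (BH.symm_slice ψ hψ v)
      intro c φ hφ σ x
      simp [hφ σ x]
    linarith
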